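/- arXiv:math/0612433 — 2 statements merged into one kernel-verified Lean document; each statement's English description precedes it below -/
import Mathlib

section
/- Let c > 0 and p ≥ 1. Then lim_{h → 0⁺} h · ∫_c^∞ [ ∫_c^∞ (uv)^{−1/4} exp(√(uv) − (u+v)/2 − hv/p) dv ]^p du = (2√(2π))^p, i.e. the function of h given by this expression tends to (2√(2π))^p as h tends to 0 from the right. -/
open MeasureTheory Filter Set

/-- the integrand in the statement -/
noncomputable def kerK (p h u v : ℝ) : ℝ :=
  (u * v) ^ (-(1 / 4) : ℝ) * Real.exp (Real.sqrt (u * v) - (u + v) / 2 - h * v / p)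

/-- the integrand after substitution -/
noncomputable def kerJ (p h x t : ℝ) : ℝ :=
  2 * Real.sqrt (1 + t / x) * Real.exp (-t ^ 2 / 2 - h * (x + t) ^ 2 / p)

lemma kerK_subst (p h x y : ℝ) (hx : 0 < x) (hy : 0 < y) :
    (2 * y) * kerK p h (x ^ 2) (y ^ 2) = kerJ p h x (y - x) := by
  unfold kerK kerJ
  have h1 : x ^ 2 * y ^ 2 = (x * y) ^ 2 := by ring
  have hxy : 0 < x * y := mul_pos hx hy
  have h2 : ((x * y) ^ 2) ^ (-(1 / 4) : ℝ) = (Real.sqrt (x * y))⁻¹ := by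
    rw [Real.sqrt_eq_rpow, ← Real.rpow_neg hxy.le, ← Real.rpow_natCast, ← Real.rpow_mul hxy.le]
    norm_num
  have h3 : Real.sqrt (1 + (y - x) / x) = y * (Real.sqrt (x * y))⁻¹ := by
    have : 1 + (y - x) / x = (y * (Real.sqrt (x * y))⁻¹) ^ 2 := by
      rw [mul_pow, inv_pow, Real.sq_sqrt hxy.le]
      field_simp
      ring
    rw [this, Real.sqrt_sq (by positivity)]
  rw [h1, h2, h3, Real.sqrt_sq hxy.le, ← mul_assoc]
  congr 1
  · ring
  · congr 1
    ring

lemma inner_subst (c p h x : ℝ) (hc : 0 < c) (hx : 0 < x) :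
    ∫ v in Ioi c, kerK p h (x ^ 2) v = ∫ t in Ioi (Real.sqrt c - x), kerJ p h x t := by
  have hsc : 0 < Real.sqrt c := Real.sqrt_pos.2 hc
  have himg : (fun t : ℝ => (x + t) ^ 2) '' Ioi (Real.sqrt c - x) = Ioi c := by
    ext v
    simp only [mem_image, mem_Ioi]
    constructor
    · rintro ⟨t, ht, rfl⟩
      exact Real.lt_sq_of_sqrt_lt (by linarith)
    · intro hv
      refine ⟨Real.sqrt v - x, ?_, ?_⟩
      · have := Real.sqrt_lt_sqrt hc.le hv
        linarith
      · rw [add_sub_cancel, Real.sq_sqrt (by linarith)]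
  rw [← himg, integral_image_eq_integral_abs_deriv_smul (f' := fun t => 2 * (x + t))
    measurableSet_Ioi]
  · refine setIntegral_congr_fun measurableSet_Ioi fun t ht => ?_
    have ht' : 0 < x + t := by
      have := mem_Ioi.1 ht
      linarith
    simp only [smul_eq_mul]
    rw [abs_of_pos (by positivity), kerK_subst p h x (x + t) hx ht', add_sub_cancel_left]
  · intro t _
    have := ((hasDerivAt_id t).const_add x).pow 2
    simp only [id] at this
    refine HasDerivAt.hasDerivWithinAt ?_
    have e : ((2 : ℕ) : ℝ) * (x + t) ^ (2 - 1) * 1 = 2 * (x + t) := by norm_num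
    rw [e] at this
    exact this
  · intro a ha b hb hab
    have h1 := mem_Ioi.1 ha
    have h2 := mem_Ioi.1 hb
    have : x + a = x + b := by
      refine (pow_left_inj₀ (by linarith) (by linarith) two_ne_zero).1 hab
    linarith

lemma kerJ_nonneg (p h x t : ℝ) : 0 ≤ kerJ p h x t := by
  unfold kerJ; positivity

lemma kerJ_bound (c p h x t : ℝ) (hc : 0 < c) (hp : 1 ≤ p) (hh : 0 < h) (hh4 : h ≤ 1 / 4)
    (hx : Real.sqrt c ≤ x) :
    kerJ p h x t ≤ Real.exp (-(h * x ^ 2 / (2 * p))) *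
      (2 * (1 + |t| / Real.sqrt c) * Real.exp (-(1 / 4) * t ^ 2)) := by
  have hsc : 0 < Real.sqrt c := Real.sqrt_pos.2 hc
  have hx0 : 0 < x := by linarith
  have hp0 : 0 < p := by linarith
  have h1 : Real.sqrt (1 + t / x) ≤ 1 + |t| / Real.sqrt c := by
    have h2 : t / x ≤ |t| / Real.sqrt c := by
      calc t / x ≤ |t| / x := by gcongr; exact le_abs_self t
        _ ≤ _ := by gcongr
    have h3 : 0 ≤ |t| / Real.sqrt c := by positivity
    rw [Real.sqrt_le_left (by positivity)]
    nlinarith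
  have h4 : Real.exp (-t ^ 2 / 2 - h * (x + t) ^ 2 / p) ≤
      Real.exp (-(h * x ^ 2 / (2 * p))) * Real.exp (-(1 / 4) * t ^ 2) := by
    rw [← Real.exp_add, Real.exp_le_exp]
    obtain ⟨a, ha⟩ : ∃ a, a = h / p := ⟨_, rfl⟩
    have e1 : h * (x + t) ^ 2 / p = a * (x + t) ^ 2 := by rw [ha]; ring
    have e2 : h * x ^ 2 / (2 * p) = a * x ^ 2 / 2 := by rw [ha]; field_simp
    have ha0 : 0 < a := by rw [ha]; positivity
    have ha4 : a ≤ 1 / 4 := by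
      rw [ha, div_le_iff₀ hp0]; nlinarith
    rw [e1, e2]
    nlinarith [mul_nonneg ha0.le (sq_nonneg (x + 2 * t)), mul_nonneg (sub_nonneg.2 ha4) (sq_nonneg t)]
  unfold kerJ
  calc _ ≤ 2 * (1 + |t| / Real.sqrt c) *
        (Real.exp (-(h * x ^ 2 / (2 * p))) * Real.exp (-(1 / 4) * t ^ 2)) := by gcongr
    _ = _ := by ring

lemma dom_integrable (d : ℝ) :
    Integrable (fun t : ℝ => 2 * (1 + |t| / d) * Real.exp (-(1 / 4) * t ^ 2)) := by
  have h1 : Integrable (fun t : ℝ => Real.exp (-(1 / 4) * t ^ 2)) :=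
    integrable_exp_neg_mul_sq (by norm_num)
  have h2 : Integrable (fun t : ℝ => t * Real.exp (-(1 / 4) * t ^ 2)) :=
    integrable_mul_exp_neg_mul_sq (by norm_num)
  have h3 := (h1.const_mul 2).add (h2.norm.const_mul (2 / d))
  refine h3.congr (Eventually.of_forall fun t => ?_)
  simp only [Pi.add_apply, norm_mul, Real.norm_eq_abs, Real.abs_exp]
  ring

lemma kerJ_measurable (p h x : ℝ) : Measurable (kerJ p h x) := by
  unfold kerJ
  fun_prop

/-- the inner integral -/
noncomputable def innerF (c p h u : ℝ) : ℝ := ∫ v in Ioi c, kerK p h u v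

lemma innerF_measurable (c p h : ℝ) : Measurable (innerF c p h) := by
  have : Measurable (fun z : ℝ × ℝ => kerK p h z.1 z.2) := by
    unfold kerK
    fun_prop
  exact (this.stronglyMeasurable.integral_prod_right' (ν := volume.restrict (Ioi c))).measurable

lemma innerF_nonneg (c p h u : ℝ) (hc : 0 < c) (hu : 0 < u) : 0 ≤ innerF c p h u := by
  refine setIntegral_nonneg measurableSet_Ioi fun v hv => ?_
  have : 0 < v := hc.trans hv
  unfold kerK
  positivity

lemma innerF_eq (c p h u : ℝ) (hc : 0 < c) (hu : 0 < u) :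
    innerF c p h u = ∫ t, (Ioi (Real.sqrt c - Real.sqrt u)).indicator
      (kerJ p h (Real.sqrt u)) t := by
  rw [integral_indicator measurableSet_Ioi, ← inner_subst c p h _ hc (Real.sqrt_pos.2 hu),
    Real.sq_sqrt hu.le, innerF]

lemma ind_le (s : Set ℝ) (p h x t : ℝ) : ‖s.indicator (kerJ p h x) t‖ ≤ kerJ p h x t := by
  refine (norm_indicator_le_norm_self _ _).trans ?_
  rw [Real.norm_eq_abs, abs_of_nonneg (kerJ_nonneg p h x t)]

/-- the constant in the bound -/
noncomputable def domC (c : ℝ) : ℝ :=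
  ∫ t : ℝ, 2 * (1 + |t| / Real.sqrt c) * Real.exp (-(1 / 4) * t ^ 2)

lemma domC_nonneg (c : ℝ) : 0 ≤ domC c := by
  refine integral_nonneg fun t => ?_
  simp only [Pi.zero_apply]
  positivity

lemma innerF_bound (c p h u : ℝ) (hc : 0 < c) (hp : 1 ≤ p) (hh : 0 < h) (hh4 : h ≤ 1 / 4)
    (hu : c ≤ u) : innerF c p h u ≤ Real.exp (-(h * u / (2 * p))) * domC c := by
  have hu0 : 0 < u := by linarith
  rw [innerF_eq c p h u hc hu0, domC, ← integral_const_mul]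
  refine (le_abs_self _).trans ?_
  rw [← Real.norm_eq_abs]
  refine norm_integral_le_of_norm_le ((dom_integrable _).const_mul _)
    (Eventually.of_forall fun t => (ind_le _ _ _ _ _).trans ?_)
  have := kerJ_bound c p h (Real.sqrt u) t hc hp hh hh4 (Real.sqrt_le_sqrt hu)
  rwa [Real.sq_sqrt hu0.le] at this

lemma small_h (c s : ℝ) (hc : 0 < c) (hs : 0 < s) :
    ∀ᶠ h in nhdsWithin (0 : ℝ) (Ioi 0), 0 < h ∧ h ≤ 1 / 4 ∧ c * h < s := by
  have h1 : ∀ᶠ h in nhdsWithin (0 : ℝ) (Ioi 0), 0 < h := self_mem_nhdsWithin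
  have h2 : ∀ᶠ h in nhdsWithin (0 : ℝ) (Ioi 0), h < 1 / 4 :=
    nhdsWithin_le_nhds (eventually_lt_nhds (by norm_num))
  have h3 : ∀ᶠ h in nhdsWithin (0 : ℝ) (Ioi 0), h < s / c :=
    nhdsWithin_le_nhds (eventually_lt_nhds (by positivity))
  filter_upwards [h1, h2, h3] with h a b d
  refine ⟨a, b.le, ?_⟩
  rw [lt_div_iff₀ hc] at d
  linarith

lemma innerF_tendsto (c p s : ℝ) (hc : 0 < c) (hp : 1 ≤ p) (hs : 0 < s) :
    Tendsto (fun h => innerF c p h (s / h)) (nhdsWithin 0 (Ioi 0))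
      (nhds (2 * Real.sqrt (2 * Real.pi) * Real.exp (-(s / p)))) := by
  have hss : 0 < Real.sqrt s := Real.sqrt_pos.2 hs
  have hval : 2 * Real.sqrt (2 * Real.pi) * Real.exp (-(s / p)) =
      ∫ t : ℝ, 2 * Real.exp (-(s / p)) * Real.exp (-(1 / 2) * t ^ 2) := by
    rw [integral_const_mul, integral_gaussian]
    have : Real.pi / (1 / 2) = 2 * Real.pi := by ring
    rw [this]; ring
  have key : Tendsto (fun h => ∫ t, (Ioi (Real.sqrt c - Real.sqrt (s / h))).indicator
      (kerJ p h (Real.sqrt (s / h))) t) (nhdsWithin 0 (Ioi 0))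
      (nhds (∫ t : ℝ, 2 * Real.exp (-(s / p)) * Real.exp (-(1 / 2) * t ^ 2))) := by
    refine tendsto_integral_filter_of_dominated_convergence
      (fun t : ℝ => 2 * (1 + |t| / Real.sqrt c) * Real.exp (-(1 / 4) * t ^ 2))
      (Eventually.of_forall fun h =>
        ((kerJ_measurable _ _ _).indicator measurableSet_Ioi).aestronglyMeasurable)
      ?_ (dom_integrable _) (Eventually.of_forall fun t => ?_)
    · filter_upwards [small_h c s hc hs] with h ⟨h0, h4, hcs⟩
      refine Eventually.of_forall fun t => (ind_le _ _ _ _ _).trans ?_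
      refine (kerJ_bound c p h (Real.sqrt (s / h)) t hc hp h0 h4
        (Real.sqrt_le_sqrt ((le_div_iff₀ h0).2 hcs.le))).trans ?_
      refine mul_le_of_le_one_left (by positivity) (Real.exp_le_one_iff.2 ?_)
      have : 0 ≤ h * Real.sqrt (s / h) ^ 2 / (2 * p) := by positivity
      linarith
    · have hev : ∀ᶠ h in nhdsWithin (0 : ℝ) (Ioi 0),
          2 * Real.sqrt (1 + t * Real.sqrt h / Real.sqrt s) *
            Real.exp (-t ^ 2 / 2 - (Real.sqrt s + Real.sqrt h * t) ^ 2 / p) =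
          (Ioi (Real.sqrt c - Real.sqrt (s / h))).indicator (kerJ p h (Real.sqrt (s / h))) t := by
        have hd : 0 < (Real.sqrt c + |t| + 1) ^ 2 := by positivity
        filter_upwards [small_h _ s hd hs] with h ⟨h0, h4, hcs⟩
        have hsh : 0 < Real.sqrt h := Real.sqrt_pos.2 h0
        have hm : t ∈ Ioi (Real.sqrt c - Real.sqrt (s / h)) := by
          have h1 : Real.sqrt c + |t| + 1 ≤ Real.sqrt (s / h) :=
            Real.le_sqrt_of_sq_le ((le_div_iff₀ h0).2 hcs.le)
          have := neg_abs_le t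
          rw [mem_Ioi]; linarith
        rw [indicator_of_mem hm, kerJ, Real.sqrt_div hs.le]
        have e1 : t / (Real.sqrt s / Real.sqrt h) = t * Real.sqrt h / Real.sqrt s := by
          field_simp
        have e2 : h * (Real.sqrt s / Real.sqrt h + t) ^ 2 = (Real.sqrt s + Real.sqrt h * t) ^ 2 := by
          nth_rewrite 1 [← Real.sq_sqrt h0.le]
          rw [← mul_pow]
          congr 1
          field_simp
        rw [e1, e2]
      refine Tendsto.congr' hev ?_
      have hcont : Continuous (fun h : ℝ => 2 * Real.sqrt (1 + t * Real.sqrt h / Real.sqrt s) *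
            Real.exp (-t ^ 2 / 2 - (Real.sqrt s + Real.sqrt h * t) ^ 2 / p)) := by
        fun_prop
      have := (hcont.tendsto 0).mono_left (nhdsWithin_le_nhds (s := Ioi 0))
      convert this using 2
      simp only [Real.sqrt_zero, mul_zero, zero_div, add_zero, Real.sqrt_one, zero_mul, mul_one,
        Real.sq_sqrt hs.le]
      rw [mul_assoc, ← Real.exp_add]
      congr 2
      ring
  rw [hval]
  refine Tendsto.congr' ?_ key
  filter_upwards [self_mem_nhdsWithin] with h hh
  exact (innerF_eq c p h (s / h) hc (div_pos hs hh)).symm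

lemma outer_scale (c p h : ℝ) (hc : 0 < c) (hh : 0 < h) :
    h * ∫ u in Ioi c, innerF c p h u ^ p =
      ∫ s in Ioi 0, (Ioi (h * c)).indicator (fun s => innerF c p h (s / h) ^ p) s := by
  have h1 := integral_comp_mul_left_Ioi (fun s => innerF c p h (s / h) ^ p) c hh
  simp only [mul_div_cancel_left₀ _ hh.ne', smul_eq_mul] at h1
  rw [h1, ← mul_assoc, mul_inv_cancel₀ hh.ne', one_mul, integral_indicator measurableSet_Ioi,
    Measure.restrict_restrict measurableSet_Ioi]
  congr 2
  rw [inter_eq_left.2]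
  exact Ioi_subset_Ioi (by positivity)

theorem stmt11 (c p : ℝ) (hc : 0 < c) (hp : 1 ≤ p) :
    Tendsto
      (fun h : ℝ => h * ∫ u in Ioi c,
        (∫ v in Ioi c,
            (u * v) ^ (-(1 / 4) : ℝ) *
              Real.exp (Real.sqrt (u * v) - (u + v) / 2 - h * v / p)) ^ p)
      (nhdsWithin 0 (Ioi 0)) (nhds ((2 * Real.sqrt (2 * Real.pi)) ^ p)) := by
  change Tendsto (fun h : ℝ => h * ∫ u in Ioi c, innerF c p h u ^ p) _ _
  have hp0 : 0 < p := by linarith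
  have key : Tendsto (fun h => ∫ s in Ioi 0,
      (Ioi (h * c)).indicator (fun s => innerF c p h (s / h) ^ p) s) (nhdsWithin 0 (Ioi 0))
      (nhds (∫ s in Ioi (0 : ℝ), (2 * Real.sqrt (2 * Real.pi)) ^ p * Real.exp (-s))) := by
    refine tendsto_integral_filter_of_dominated_convergence
      (fun s : ℝ => domC c ^ p * Real.exp (-(1 / 2) * s))
      (Eventually.of_forall fun h => ?_) ?_ ?_ ?_
    · refine Measurable.aestronglyMeasurable (Measurable.indicator ?_ measurableSet_Ioi)
      have := innerF_measurable c p h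
      exact (this.comp (measurable_id.div_const h)).pow_const p
    · filter_upwards [small_h 1 1 one_pos one_pos] with h ⟨h0, h4, _⟩
      refine Eventually.of_forall fun s => ?_
      have hC := domC_nonneg c
      by_cases hs : s ∈ Ioi (h * c)
      · rw [indicator_of_mem hs]
        have hcs : c ≤ s / h := by
          rw [le_div_iff₀ h0]
          have := mem_Ioi.1 hs
          linarith
        have hn := innerF_nonneg c p h (s / h) hc (by linarith)
        rw [Real.norm_eq_abs, abs_of_nonneg (by positivity)]
        calc _ ≤ (Real.exp (-(h * (s / h) / (2 * p))) * domC c) ^ p :=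
              Real.rpow_le_rpow hn (innerF_bound c p h _ hc hp h0 h4 hcs) hp0.le
          _ = _ := by
              rw [Real.mul_rpow (by positivity) hC, ← Real.exp_mul, mul_comm]
              congr 2
              field_simp
      · rw [indicator_of_notMem hs, norm_zero]
        positivity
    · have : IntegrableOn (fun s : ℝ => Real.exp (-(1 / 2) * s)) (Ioi 0) :=
        exp_neg_integrableOn_Ioi 0 (by norm_num)
      exact this.const_mul _
    · refine (ae_restrict_iff' measurableSet_Ioi).2 (Eventually.of_forall fun s hs => ?_)
      have hs0 : 0 < s := hs
      have h1 := (innerF_tendsto c p s hc hp hs0).rpow_const (p := p) (Or.inr hp0.le)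
      rw [Real.mul_rpow (by positivity) (by positivity), ← Real.exp_mul] at h1
      have e : -(s / p) * p = -s := by field_simp
      rw [e] at h1
      refine Tendsto.congr' ?_ h1
      filter_upwards [small_h c s hc hs0] with h ⟨h0, h4, hcs⟩
      rw [indicator_of_mem]
      rw [mem_Ioi]; linarith
  rw [integral_const_mul, integral_exp_neg_Ioi_zero, mul_one] at key
  refine Tendsto.congr' ?_ key
  filter_upwards [self_mem_nhdsWithin] with h hh
  exact (outer_scale c p h hc hh).symm
end

section
/- Let s > 0 and 1 ≤ p < ∞. Then the Fock space F^p_s is a complemented subspace of L^p(ℂⁿ, dv_s): the set of (equivalence classes of) functions in L^p(ℂⁿ, dv_s) admitting an entire representative is a closed linear subspace, and there exists a continuous linear map P from L^p(ℂⁿ, dv_s) to itself with P ∘ P = P whose range is exactly this subspace. -/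
open MeasureTheory

/-- `|z|² = |z₁|² + ⋯ + |zₙ|²` on `ℂⁿ`. -/
noncomputable def nsq {n : ℕ} (z : Fin n → ℂ) : ℝ := ∑ i, Complex.normSq (z i)

/-- `⟨z,w⟩ = z₁·conj w₁ + ⋯ + zₙ·conj wₙ` on `ℂⁿ`. -/
noncomputable def herm {n : ℕ} (z w : Fin n → ℂ) : ℂ := ∑ i, z i * (starRingEnd ℂ) (w i)

/-- The Gaussian probability measure `dv_t(z) = (t/π)^n e^{-t|z|²} dv(z)` on `ℂⁿ`. -/
noncomputable def gaussMeasure (n : ℕ) (t : ℝ) : Measure (Fin n → ℂ) :=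
  volume.withDensity fun z => ENNReal.ofReal ((t / Real.pi) ^ n * Real.exp (-t * nsq z))

@[fun_prop]
lemma continuous_nsq {n : ℕ} : Continuous (nsq (n := n)) := by
  unfold nsq
  exact continuous_finsetSum _ fun i _ => Complex.continuous_normSq.comp (continuous_apply i)

lemma continuous_herm_right {n : ℕ} (z : Fin n → ℂ) : Continuous (fun w => herm z w) := by
  unfold herm
  exact continuous_finsetSum _ fun i _ =>
    continuous_const.mul (Complex.continuous_conj.comp (continuous_apply i))

lemma continuous_herm_left {n : ℕ} (w : Fin n → ℂ) : Continuous (fun z => herm z w) := by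
  unfold herm
  exact continuous_finsetSum _ fun i _ => (continuous_apply i).mul continuous_const

lemma nsq_nonneg {n : ℕ} (z : Fin n → ℂ) : 0 ≤ nsq z :=
  Finset.sum_nonneg fun _ _ => Complex.normSq_nonneg _

lemma integrable_gauss_one {b : ℝ} (hb : 0 < b) :
    Integrable (fun z : ℂ => Real.exp (-b * Complex.normSq z)) := by
  have h := (GaussianFourier.integrable_cexp_neg_mul_sq_norm_add (V := ℂ) (b := (b : ℂ))
    (by simpa using hb) 0 0).norm
  refine h.congr (Filter.Eventually.of_forall fun z => ?_)
  simp only [Complex.norm_exp, Complex.normSq_eq_norm_sq]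
  congr 1
  have : (-(b:ℂ) * (‖z‖:ℂ)^2 + 0 * ((inner ℝ (0:ℂ) z : ℝ) : ℂ)) = ((-b * ‖z‖^2 : ℝ) : ℂ) := by
    push_cast; ring
  rw [this, Complex.ofReal_re]

lemma integrable_gauss {n : ℕ} {b : ℝ} (hb : 0 < b) :
    Integrable (fun z : Fin n → ℂ => Real.exp (-b * nsq z)) := by
  have := Integrable.fintype_prod (ι := Fin n) (μ := fun _ => (volume : Measure ℂ))
    (f := fun _ z => Real.exp (-b * Complex.normSq z))
    (fun _ => integrable_gauss_one hb)
  refine this.congr (Filter.Eventually.of_forall fun z => ?_)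
  simp only [nsq, ← Real.exp_sum, Finset.mul_sum]

lemma jensen_pow {X : Type*} [MeasurableSpace X] (ν : Measure X) {p : ℝ} (hp : 1 ≤ p)
    {G : X → ENNReal} (hG : AEMeasurable G ν) :
    (∫⁻ w, G w ∂ν) ^ p ≤ (∫⁻ w, G w ^ p ∂ν) * ν Set.univ ^ (p - 1) := by
  have h := eLpNorm'_le_eLpNorm'_mul_rpow_measure_univ (μ := ν) (f := G) one_pos hp
    hG.aestronglyMeasurable
  have hp0 : 0 < p := by linarith
  have h2 := ENNReal.rpow_le_rpow h hp0.le
  rw [ENNReal.mul_rpow_of_nonneg _ _ hp0.le] at h2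
  simp only [eLpNorm', enorm_eq_self, ENNReal.rpow_one, ← ENNReal.rpow_mul, div_one] at h2
  rw [one_div_mul_cancel hp0.ne', ENNReal.rpow_one, show (1 - 1/p) * p = p - 1 by field_simp] at h2
  exact h2

lemma young_pow {n : ℕ} {p : ℝ} (hp : 1 ≤ p) {G k : (Fin n → ℂ) → ENNReal}
    (hG : AEMeasurable G volume) (hk : Measurable k) :
    ∫⁻ z, (∫⁻ w, G w * k (z - w)) ^ p ≤ (∫⁻ w, k w) ^ p * ∫⁻ w, G w ^ p := by
  have hp0 : 0 < p := by linarith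
  have hkz : ∀ z : Fin n → ℂ, Measurable fun w => k (z - w) := fun z => by fun_prop
  have h1 : ∀ z, (∫⁻ w, G w * k (z - w)) ^ p ≤
      (∫⁻ w, G w ^ p * k (z - w)) * (∫⁻ w, k w) ^ (p - 1) := by
    intro z
    have h := jensen_pow (volume.withDensity fun w => k (z - w)) hp (G := G)
      (hG.mono_ac (withDensity_absolutelyContinuous _ _))
    rw [lintegral_withDensity_eq_lintegral_mul₀ (hkz z).aemeasurable hG,
      lintegral_withDensity_eq_lintegral_mul₀ (hkz z).aemeasurable (hG.pow_const p),
      withDensity_apply _ MeasurableSet.univ, Measure.restrict_univ,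
      lintegral_sub_left_eq_self k z] at h
    simpa only [Pi.mul_apply, mul_comm] using h
  have hmeas : AEMeasurable (Function.uncurry fun (z w : Fin n → ℂ) => G w ^ p * k (z - w))
      ((volume : Measure (Fin n → ℂ)).prod volume) := by
    refine AEMeasurable.mul ?_ ?_
    · exact (hG.pow_const p).comp_snd
    · exact (hk.comp (measurable_fst.sub measurable_snd)).aemeasurable
  calc ∫⁻ z, (∫⁻ w, G w * k (z - w)) ^ p
      ≤ ∫⁻ z, (∫⁻ w, G w ^ p * k (z - w)) * (∫⁻ w, k w) ^ (p - 1) := lintegral_mono h1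
    _ = (∫⁻ z, (∫⁻ w, G w ^ p * k (z - w))) * (∫⁻ w, k w) ^ (p - 1) := by
        refine lintegral_mul_const'' _ ?_
        exact hmeas.lintegral_prod_right'
    _ = (∫⁻ w, G w ^ p * ∫⁻ z, k z) * (∫⁻ w, k w) ^ (p - 1) := by
        rw [lintegral_lintegral_swap hmeas]
        congr 1
        refine lintegral_congr fun w => ?_
        rw [lintegral_const_mul _ (by fun_prop), lintegral_sub_right_eq_self k w]
    _ = (∫⁻ w, k w) ^ p * ∫⁻ w, G w ^ p := by
        rw [lintegral_mul_const'' _ (hG.pow_const p), mul_assoc, mul_comm]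
        congr 1
        nth_rewrite 1 [← ENNReal.rpow_one (∫⁻ z, k z)]
        rw [← ENNReal.rpow_add_of_nonneg _ _ zero_le_one (by linarith)]
        congr 1; ring

/-- mean value property for circular measures -/
lemma gauss_mean {n : ℕ} {b : ℝ} {F : (Fin n → ℂ) → ℂ} (hF : Differentiable ℂ F)
    (hint : Integrable fun u => F u * Real.exp (-b * nsq u)) :
    ∫ u, F u * Real.exp (-b * nsq u) = F 0 * ∫ u : Fin n → ℂ, Real.exp (-b * nsq u) := by
  set H : (Fin n → ℂ) → ℂ := fun u => F u * Real.exp (-b * nsq u) with hH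
  have hHc : Continuous H := by
    have := hF.continuous
    fun_prop
  have hrot : ∀ θ : ℝ, MeasurePreserving (fun u : Fin n → ℂ => circleMap 0 1 θ • u) := by
    intro θ
    have h := volume_preserving_pi (fun _ : Fin n =>
      (rotation (Circle.exp θ)).measurePreserving)
    convert h using 2 with u
    ext i
    simp [circleMap]
  have hcm : ∀ θ u, ‖circleMap 0 1 θ • u‖ = ‖(u : Fin n → ℂ)‖ := by
    intro θ u; rw [norm_smul]; simp [circleMap]
  have hnsq : ∀ θ (u : Fin n → ℂ), nsq (circleMap 0 1 θ • u) = nsq u := by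
    intro θ u
    simp [nsq, circleMap, Complex.normSq_eq_norm_sq]
  have hemb : ∀ θ : ℝ, MeasurableEmbedding (fun u : Fin n → ℂ => circleMap 0 1 θ • u) := by
    intro θ
    exact (Homeomorph.smulOfNeZero (circleMap 0 1 θ) (by simp [circleMap])).measurableEmbedding
  have e1 : ∀ θ : ℝ, ∫ u, H (circleMap 0 1 θ • u) = ∫ u, H u := fun θ =>
    (hrot θ).integral_comp (hemb θ) H
  have hcont : Continuous (Function.uncurry fun (θ : ℝ) (u : Fin n → ℂ) => H (circleMap 0 1 θ • u)) := by
    have : Continuous fun q : ℝ × (Fin n → ℂ) => circleMap 0 1 q.1 • q.2 :=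
      ((continuous_circleMap 0 1).comp continuous_fst).smul continuous_snd
    exact hHc.comp this
  have hprod : Integrable (Function.uncurry fun (θ : ℝ) (u : Fin n → ℂ) => H (circleMap 0 1 θ • u))
      ((volume.restrict (Set.uIoc 0 (2 * Real.pi))).prod volume) := by
    rw [integrable_prod_iff hcont.aestronglyMeasurable]
    constructor
    · exact Filter.Eventually.of_forall fun θ => ((hrot θ).integrable_comp_emb (hemb θ)).2 hint
    · have : ∀ θ : ℝ, ∫ u, ‖H (circleMap 0 1 θ • u)‖ = ∫ u, ‖H u‖ := fun θ =>
        (hrot θ).integral_comp (hemb θ) (fun u => ‖H u‖)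
      simp only [Function.uncurry, this]
      have : IsFiniteMeasure (volume.restrict (Set.uIoc 0 (2 * Real.pi))) := ⟨by simp [Set.uIoc]⟩
      exact integrable_const _
  have e2 : ∫ θ in (0:ℝ)..(2 * Real.pi), ∫ u, H (circleMap 0 1 θ • u) =
      ∫ u, ∫ θ in (0:ℝ)..(2 * Real.pi), H (circleMap 0 1 θ • u) :=
    intervalIntegral_integral_swap hprod
  have e3 : ∀ u, ∫ θ in (0:ℝ)..(2 * Real.pi), H (circleMap 0 1 θ • u) =
      (2 * Real.pi) * (F 0 * Real.exp (-b * nsq u)) := by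
    intro u
    have hd : Differentiable ℂ fun t : ℂ => F (t • u) :=
      hF.comp (differentiable_id.smul_const u)
    have := (hd.diffContOnCl (s := Metric.ball 0 |1|)).circleAverage
    rw [Real.circleAverage_def] at this
    simp only [hH, hnsq]
    rw [intervalIntegral.integral_mul_const]
    have hpi : (2 * Real.pi) ≠ 0 := by positivity
    rw [inv_smul_eq_iff₀ hpi] at this
    rw [this]
    simp [mul_assoc]
  simp only [e1, e3] at e2
  rw [intervalIntegral.integral_const, integral_const_mul, integral_const_mul, integral_complex_ofReal] at e2
  have hpi : ((2 * Real.pi : ℝ) : ℂ) ≠ 0 := by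
    exact_mod_cast (by positivity : 2 * Real.pi ≠ 0)
  simp only [sub_zero, Complex.real_smul] at e2
  push_cast at e2 hpi
  exact mul_left_cancel₀ hpi e2

lemma norm_herm_le {n : ℕ} (z w : Fin n → ℂ) : ‖herm z w‖ ≤ 2 * nsq z + nsq w / 8 := by
  unfold herm nsq
  refine (norm_sum_le _ _).trans ?_
  rw [Finset.mul_sum, Finset.sum_div, ← Finset.sum_add_distrib]
  refine Finset.sum_le_sum fun i _ => ?_
  rw [norm_mul, Complex.normSq_eq_norm_sq, Complex.normSq_eq_norm_sq, Complex.norm_conj]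
  nlinarith [sq_nonneg (‖z i‖ - ‖w i‖ / 4)]

lemma nsq_sub {n : ℕ} (z w : Fin n → ℂ) :
    nsq (z - w) = nsq z + nsq w - 2 * (herm z w).re := by
  unfold herm nsq
  rw [Complex.re_sum, Finset.mul_sum, ← Finset.sum_add_distrib, ← Finset.sum_sub_distrib]
  refine Finset.sum_congr rfl fun i _ => ?_
  simp only [Pi.sub_apply, Complex.normSq_sub]

lemma nsq_add_complex {n : ℕ} (z u : Fin n → ℂ) :
    ((nsq (z + u) : ℝ) : ℂ) = nsq z + nsq u + herm z u + herm u z := by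
  unfold herm nsq
  push_cast
  simp only [← Finset.sum_add_distrib]
  refine Finset.sum_congr rfl fun i _ => ?_
  simp only [Complex.normSq_eq_conj_mul_self, Pi.add_apply, map_add]
  ring

lemma herm_add_self {n : ℕ} (z u : Fin n → ℂ) : herm z (z + u) = nsq z + herm z u := by
  unfold herm nsq
  push_cast
  simp only [← Finset.sum_add_distrib]
  refine Finset.sum_congr rfl fun i _ => ?_
  simp only [Complex.normSq_eq_conj_mul_self, Pi.add_apply, map_add]
  ring

/-- the Fock projection with parameter `a` -/
noncomputable def fockT {n : ℕ} (a : ℝ) (f : (Fin n → ℂ) → ℂ) (z : Fin n → ℂ) : ℂ :=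
  ((∫ u : Fin n → ℂ, Real.exp (-a * nsq u) : ℝ) : ℂ)⁻¹ *
    ∫ w, f w * (Complex.exp (a * herm z w) * Real.exp (-a * nsq w))

/-- the integrability needed to make sense of `fockT` -/
def FI {n : ℕ} (a : ℝ) (f : (Fin n → ℂ) → ℂ) : Prop :=
  AEStronglyMeasurable f volume ∧ Integrable fun w => ‖f w‖ * Real.exp (-(3 / 4 * a) * nsq w)

lemma norm_kernel {n : ℕ} (a : ℝ) (z w : Fin n → ℂ) :
    ‖Complex.exp (a * herm z w) * Real.exp (-a * nsq w)‖ =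
      Real.exp (a * (herm z w).re - a * nsq w) := by
  rw [norm_mul, Complex.norm_exp, Complex.norm_real, Real.norm_eq_abs, Real.abs_exp, ← Real.exp_add]
  congr 1
  simp
  ring

lemma norm_kernel_le {n : ℕ} {a : ℝ} (ha : 0 < a) (z w : Fin n → ℂ) :
    ‖Complex.exp (a * herm z w) * Real.exp (-a * nsq w)‖ ≤
      Real.exp (2 * a * nsq z) * Real.exp (-(7 / 8 * a) * nsq w) := by
  rw [norm_kernel, ← Real.exp_add]
  refine Real.exp_le_exp.2 ?_
  have := (Complex.re_le_norm _).trans (norm_herm_le z w)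
  nlinarith [mul_le_mul_of_nonneg_left this ha.le]

lemma continuous_kernel {n : ℕ} (a : ℝ) (z : Fin n → ℂ) :
    Continuous fun w => Complex.exp (a * herm z w) * Real.exp (-a * nsq w) := by
  have := continuous_herm_right z
  fun_prop

lemma FI.integrable {n : ℕ} {a : ℝ} (ha : 0 < a) {f : (Fin n → ℂ) → ℂ} (hf : FI a f)
    (z : Fin n → ℂ) :
    Integrable fun w => f w * (Complex.exp (a * herm z w) * Real.exp (-a * nsq w)) := by
  refine (hf.2.const_mul (Real.exp (2 * a * nsq z))).mono'
    (hf.1.mul (continuous_kernel a z).aestronglyMeasurable) (Filter.Eventually.of_forall fun w => ?_)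
  rw [norm_mul]
  have h1 := norm_kernel_le ha z w
  have h2 : Real.exp (-(7 / 8 * a) * nsq w) ≤ Real.exp (-(3 / 4 * a) * nsq w) :=
    Real.exp_le_exp.2 (by nlinarith [nsq_nonneg w, mul_nonneg ha.le (nsq_nonneg w)])
  calc _ ≤ ‖f w‖ * (Real.exp (2 * a * nsq z) * Real.exp (-(3 / 4 * a) * nsq w)) := by
        gcongr; exact h1.trans (by gcongr)
    _ = _ := by ring

/-- the linear functional `z ↦ ⟨z,w⟩` -/
noncomputable def hermL {n : ℕ} (w : Fin n → ℂ) : (Fin n → ℂ) →L[ℂ] ℂ :=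
  ∑ i, (starRingEnd ℂ) (w i) • ContinuousLinearMap.proj (R := ℂ) (φ := fun _ : Fin n => ℂ) i

lemma hermL_apply {n : ℕ} (w z : Fin n → ℂ) : hermL w z = herm z w := by
  simp [hermL, herm, mul_comm]

lemma norm_hermL_le {n : ℕ} (w : Fin n → ℂ) : ‖hermL w‖ ≤ n + nsq w := by
  unfold hermL
  refine (norm_sum_le _ _).trans ?_
  have : ∀ i, ‖(starRingEnd ℂ) (w i) •
      ContinuousLinearMap.proj (R := ℂ) (φ := fun _ : Fin n => ℂ) i‖ ≤ 1 + Complex.normSq (w i) := by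
    intro i
    refine ContinuousLinearMap.opNorm_le_bound _ (by have := Complex.normSq_nonneg (w i); positivity)
      fun z => ?_
    simp only [ContinuousLinearMap.smul_apply, ContinuousLinearMap.proj_apply, smul_eq_mul, norm_mul,
      Complex.norm_conj]
    have h1 := norm_le_pi_norm z i
    rw [Complex.normSq_eq_norm_sq]
    gcongr
    nlinarith [sq_nonneg (‖w i‖ - 1 / 2)]
  refine (Finset.sum_le_sum fun i _ => this i).trans ?_
  simp [Finset.sum_add_distrib, nsq]

lemma FI.differentiable {n : ℕ} {a : ℝ} (ha : 0 < a) {f : (Fin n → ℂ) → ℂ} (hf : FI a f) :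
    Differentiable ℂ (fockT a f) := by
  unfold fockT
  refine Differentiable.const_mul ?_ _
  intro z₀
  have hder : ∀ w z, HasFDerivAt
      (fun z => f w * (Complex.exp (a * herm z w) * Real.exp (-a * nsq w)))
      ((f w * (Complex.exp (a * herm z w) * Real.exp (-a * nsq w))) • ((a : ℂ) • hermL w)) z := by
    intro w z
    have h0 : HasFDerivAt (fun z => (a : ℂ) * herm z w) ((a : ℂ) • hermL w) z := by
      have := ((hermL w).hasFDerivAt (x := z)).const_mul (a : ℂ)
      simpa only [hermL_apply] using this
    have := ((h0.cexp).mul_const ((Real.exp (-a * nsq w) : ℝ) : ℂ)).const_mul (f w)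
    refine this.congr_fderiv ?_
    ext v
    simp
    ring
  have hcL : Continuous fun w : Fin n → ℂ => hermL w := by
    unfold hermL
    refine continuous_finsetSum _ fun i _ => ?_
    exact (Complex.continuous_conj.comp (continuous_apply i)).smul continuous_const
  obtain ⟨M, hM⟩ : ∃ M, ∀ᶠ z in nhds z₀, nsq z < M :=
    ⟨nsq z₀ + 1, continuous_nsq.continuousAt.eventually_lt_const (by linarith)⟩
  refine (hasFDerivAt_integral_of_dominated_of_fderiv_le (s := {z | nsq z < M})
    (bound := fun w => (Real.exp (2 * a * M) * (a * (n + 8 / a))) *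
      (‖f w‖ * Real.exp (-(3 / 4 * a) * nsq w)))
    (F' := fun z w => (f w * (Complex.exp (a * herm z w) * Real.exp (-a * nsq w))) •
      ((a : ℂ) • hermL w)) hM
    (Filter.Eventually.of_forall fun z => hf.1.mul (continuous_kernel a z).aestronglyMeasurable)
    (hf.integrable ha z₀) ?_ ?_ (hf.2.const_mul _)
    (Filter.Eventually.of_forall fun w z _ => hder w z)).differentiableAt
  · exact (hf.1.mul (continuous_kernel a z₀).aestronglyMeasurable).smul
      (hcL.const_smul (a : ℂ)).aestronglyMeasurable
  · refine Filter.Eventually.of_forall fun w z hz => ?_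
    have hz : nsq z < M := hz
    rw [norm_smul, norm_smul, norm_mul, Complex.norm_real, Real.norm_eq_abs, abs_of_pos ha]
    have h1 := norm_kernel_le ha z w
    have h3 : Real.exp (2 * a * nsq z) ≤ Real.exp (2 * a * M) :=
      Real.exp_le_exp.2 (by nlinarith)
    have h2 : ‖hermL w‖ ≤ (n + 8 / a) * Real.exp (1 / 8 * a * nsq w) := by
      refine (norm_hermL_le w).trans ?_
      have hy : 0 ≤ 1 / 8 * a * nsq w := by have := nsq_nonneg w; positivity
      have e1 := Real.one_le_exp hy
      have e2 : nsq w ≤ 8 / a * Real.exp (1 / 8 * a * nsq w) := by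
        have := Real.add_one_le_exp (1 / 8 * a * nsq w)
        calc nsq w = 8 / a * (1 / 8 * a * nsq w) := by field_simp
          _ ≤ _ := by gcongr; linarith
      have : (n : ℝ) ≤ n * Real.exp (1 / 8 * a * nsq w) := le_mul_of_one_le_right (by positivity) e1
      linarith
    have h4 : Real.exp (-(3 / 4 * a) * nsq w) =
        Real.exp (-(7 / 8 * a) * nsq w) * Real.exp (1 / 8 * a * nsq w) := by
      rw [← Real.exp_add]; congr 1; ring
    rw [h4]
    calc _ ≤ ‖f w‖ * (Real.exp (2 * a * M) * Real.exp (-(7 / 8 * a) * nsq w)) *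
          (a * ((n + 8 / a) * Real.exp (1 / 8 * a * nsq w))) := by
          gcongr
          exact h1.trans (by gcongr)
      _ = _ := by ring

lemma gauss_pos {n : ℕ} {a : ℝ} (ha : 0 < a) :
    0 < ∫ u : Fin n → ℂ, Real.exp (-a * nsq u) := integral_exp_pos (integrable_gauss ha)

lemma FI.reproduce {n : ℕ} {a : ℝ} (ha : 0 < a) {f : (Fin n → ℂ) → ℂ} (hf : FI a f)
    (hd : Differentiable ℂ f) (z : Fin n → ℂ) : fockT a f z = f z := by
  unfold fockT
  have key : ∀ u, f (z + u) * (Complex.exp (a * herm z (z + u)) * Real.exp (-a * nsq (z + u))) =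
      (f (z + u) * Complex.exp (-a * herm u z)) * Real.exp (-a * nsq u) := by
    intro u
    rw [mul_assoc]
    congr 1
    push_cast
    rw [← Complex.exp_add, ← Complex.exp_add, nsq_add_complex, herm_add_self]
    congr 1
    ring
  have hint := (hf.integrable ha z).comp_add_left z
  rw [← integral_add_left_eq_self
    (fun w => f w * (Complex.exp (a * herm z w) * Real.exp (-a * nsq w))) z]
  simp only [key] at hint ⊢
  rw [gauss_mean (F := fun u => f (z + u) * Complex.exp (-a * herm u z)) ?_ hint]
  · have h0 : herm 0 z = 0 := by simp [herm]
    have : ((∫ u : Fin n → ℂ, Real.exp (-a * nsq u) : ℝ) : ℂ) ≠ 0 := by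
      exact_mod_cast (gauss_pos ha).ne'
    simp only [h0, add_zero, mul_zero, Complex.exp_zero, mul_one]
    rw [mul_left_comm, inv_mul_cancel₀ this, mul_one]
  · have h1 : Differentiable ℂ fun u => herm u z := by
      have := (hermL z).differentiable
      rwa [show ⇑(hermL z) = fun u => herm u z from funext fun u => hermL_apply z u] at this
    have h2 : Differentiable ℂ fun u => f (z + u) := hd.comp (differentiable_id.const_add z)
    exact h2.mul (h1.const_mul _).cexp

/-- weighted absolute value -/
noncomputable def wt {n : ℕ} (a : ℝ) (f : (Fin n → ℂ) → ℂ) (w : Fin n → ℂ) : ENNReal :=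
  ‖f w‖ₑ * ENNReal.ofReal (Real.exp (-(a / 2) * nsq w))

lemma eLpNorm_gauss {n : ℕ} {s p a : ℝ} (hp : 1 ≤ p) (hs : 0 < s) (hap : a * p = 2 * s)
    (f : (Fin n → ℂ) → ℂ) :
    eLpNorm f (ENNReal.ofReal p) (gaussMeasure n s) =
      (ENNReal.ofReal ((s / Real.pi) ^ n) * ∫⁻ w, wt a f w ^ p) ^ (1 / p) := by
  have hp0 : 0 < p := by linarith
  rw [eLpNorm_eq_lintegral_rpow_enorm_toReal (by simpa using hp0) ENNReal.ofReal_ne_top,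
    ENNReal.toReal_ofReal hp0.le]
  congr 1
  unfold gaussMeasure
  rw [lintegral_withDensity_eq_lintegral_mul_non_measurable _ (by fun_prop)
    (Filter.Eventually.of_forall fun _ => ENNReal.ofReal_lt_top),
    ← lintegral_const_mul' _ _ ENNReal.ofReal_ne_top]
  refine lintegral_congr fun w => ?_
  simp only [wt, Pi.mul_apply]
  rw [ENNReal.mul_rpow_of_nonneg _ _ hp0.le, ENNReal.ofReal_rpow_of_pos (Real.exp_pos _),
    ← Real.exp_mul, ENNReal.ofReal_mul (by positivity)]
  rw [show -(a / 2) * nsq w * p = -s * nsq w by linear_combination (-(nsq w) / 2) * hap]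
  ring

lemma ac_gauss {n : ℕ} {s : ℝ} (hs : 0 < s) :
    (volume : Measure (Fin n → ℂ)) ≪ gaussMeasure n s := by
  refine withDensity_absolutelyContinuous' (by fun_prop) (Filter.Eventually.of_forall fun w => ?_)
  have : 0 < (s / Real.pi) ^ n * Real.exp (-s * nsq w) := by positivity
  simpa using this

lemma gauss_ac {n : ℕ} {s : ℝ} : gaussMeasure n s ≪ (volume : Measure (Fin n → ℂ)) :=
  withDensity_absolutelyContinuous _ _

lemma lintegral_gauss_lt_top {n : ℕ} {b : ℝ} (hb : 0 < b) :
    ∫⁻ w : Fin n → ℂ, ENNReal.ofReal (Real.exp (-b * nsq w)) < ⊤ :=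
  (integrable_gauss hb).lintegral_lt_top

lemma FI_of_memLp {n : ℕ} {s p a : ℝ} (hp : 1 ≤ p) (hs : 0 < s) (ha : 0 < a)
    (hap : a * p = 2 * s) {f : (Fin n → ℂ) → ℂ}
    (hf : MemLp f (ENNReal.ofReal p) (gaussMeasure n s)) : FI a f := by
  have hp0 : 0 < p := by linarith
  have hm : AEStronglyMeasurable f volume := hf.1.mono_ac (ac_gauss hs)
  refine ⟨hm, ?_⟩
  have h := hf.2
  rw [eLpNorm_gauss hp hs hap, ENNReal.rpow_lt_top_iff_of_pos (by positivity)] at h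
  have hfin : ∫⁻ w, wt a f w ^ p < ⊤ := by
    refine ENNReal.lt_top_of_mul_ne_top_right h.ne ?_
    have : 0 < (s / Real.pi) ^ n := by positivity
    simpa using this
  refine ⟨hm.norm.mul (by fun_prop : Continuous _).aestronglyMeasurable, ?_⟩
  have hle : ∀ w, ‖‖f w‖ * Real.exp (-(3 / 4 * a) * nsq w)‖ₑ ≤
      ENNReal.ofReal (Real.exp (-(a / 4) * nsq w)) + wt a f w ^ p := by
    intro w
    have e1 : ‖‖f w‖ * Real.exp (-(3 / 4 * a) * nsq w)‖ₑ =
        wt a f w * ENNReal.ofReal (Real.exp (-(a / 4) * nsq w)) := by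
      rw [wt, enorm_mul, enorm_norm, mul_assoc, ← ENNReal.ofReal_mul (Real.exp_pos _).le,
        ← Real.exp_add, Real.enorm_of_nonneg (Real.exp_pos _).le]
      congr 3; ring
    have e2 : wt a f w ≤ 1 + wt a f w ^ p := by
      rcases le_total (wt a f w) 1 with h1 | h1
      · exact h1.trans le_self_add
      · calc wt a f w = wt a f w ^ (1 : ℝ) := (ENNReal.rpow_one _).symm
          _ ≤ wt a f w ^ p := ENNReal.rpow_le_rpow_of_exponent_le h1 hp
          _ ≤ _ := le_add_self
    have e3 : ENNReal.ofReal (Real.exp (-(a / 4) * nsq w)) ≤ 1 := by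
      rw [ENNReal.ofReal_le_one, Real.exp_le_one_iff]
      nlinarith [mul_nonneg ha.le (nsq_nonneg w)]
    rw [e1]
    calc _ ≤ (1 + wt a f w ^ p) * ENNReal.ofReal (Real.exp (-(a / 4) * nsq w)) := by gcongr
      _ = ENNReal.ofReal (Real.exp (-(a / 4) * nsq w)) +
          wt a f w ^ p * ENNReal.ofReal (Real.exp (-(a / 4) * nsq w)) := by ring
      _ ≤ _ := by gcongr; exact mul_le_of_le_one_right' e3
  refine (lintegral_mono hle).trans_lt ?_
  rw [lintegral_add_left (by fun_prop)]
  exact ENNReal.add_lt_top.2 ⟨lintegral_gauss_lt_top (by positivity), hfin⟩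

/-- the norm bound -/
noncomputable def fockC (n : ℕ) (a : ℝ) : ENNReal :=
  ‖((∫ u : Fin n → ℂ, Real.exp (-a * nsq u) : ℝ) : ℂ)⁻¹‖ₑ *
    ∫⁻ u : Fin n → ℂ, ENNReal.ofReal (Real.exp (-(a / 2) * nsq u))

lemma fockC_lt_top {n : ℕ} {a : ℝ} (ha : 0 < a) : fockC n a < ⊤ :=
  ENNReal.mul_lt_top enorm_lt_top (lintegral_gauss_lt_top (by positivity))

lemma wt_fockT_le {n : ℕ} (a : ℝ) (f : (Fin n → ℂ) → ℂ) (z : Fin n → ℂ) :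
    wt a (fockT a f) z ≤ ‖((∫ u : Fin n → ℂ, Real.exp (-a * nsq u) : ℝ) : ℂ)⁻¹‖ₑ *
      ∫⁻ w, wt a f w * ENNReal.ofReal (Real.exp (-(a / 2) * nsq (z - w))) := by
  unfold wt
  rw [fockT, enorm_mul, mul_assoc]
  gcongr
  calc _ ≤ (∫⁻ w, ‖f w * (Complex.exp (a * herm z w) * Real.exp (-a * nsq w))‖ₑ) *
        ENNReal.ofReal (Real.exp (-(a / 2) * nsq z)) := by
        gcongr; exact enorm_integral_le_lintegral_enorm _
    _ = ∫⁻ w, ‖f w * (Complex.exp (a * herm z w) * Real.exp (-a * nsq w))‖ₑ *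
        ENNReal.ofReal (Real.exp (-(a / 2) * nsq z)) := by
        rw [lintegral_mul_const' _ _ ENNReal.ofReal_ne_top]
    _ = _ := by
        refine lintegral_congr fun w => ?_
        rw [enorm_mul, mul_assoc, mul_assoc, ← ofReal_norm_eq_enorm (_ * _), norm_kernel,
          ← ENNReal.ofReal_mul (Real.exp_pos _).le, ← ENNReal.ofReal_mul (Real.exp_pos _).le,
          ← Real.exp_add, ← Real.exp_add, nsq_sub]
        congr 3; ring

lemma eLpNorm_fockT_le {n : ℕ} {s p a : ℝ} (hp : 1 ≤ p) (hs : 0 < s)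
    (hap : a * p = 2 * s) {f : (Fin n → ℂ) → ℂ}
    (hf : AEStronglyMeasurable f (gaussMeasure n s)) :
    eLpNorm (fockT a f) (ENNReal.ofReal p) (gaussMeasure n s) ≤
      fockC n a * eLpNorm f (ENNReal.ofReal p) (gaussMeasure n s) := by
  have hp0 : 0 < p := by linarith
  have hm : AEStronglyMeasurable f volume := hf.mono_ac (ac_gauss hs)
  have hwm : AEMeasurable (wt a f) volume := by
    unfold wt
    exact hm.enorm.mul (by fun_prop)
  rw [eLpNorm_gauss hp hs hap, eLpNorm_gauss hp hs hap]
  have hC : fockC n a = (fockC n a ^ p) ^ (1 / p) := by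
    rw [← ENNReal.rpow_mul, mul_one_div_cancel hp0.ne', ENNReal.rpow_one]
  rw [hC, ← ENNReal.mul_rpow_of_nonneg _ _ (by positivity)]
  refine ENNReal.rpow_le_rpow ?_ (by positivity)
  rw [mul_left_comm]
  gcongr
  calc ∫⁻ z, wt a (fockT a f) z ^ p
      ≤ ∫⁻ z, ‖((∫ u : Fin n → ℂ, Real.exp (-a * nsq u) : ℝ) : ℂ)⁻¹‖ₑ ^ p *
        (∫⁻ w, wt a f w * ENNReal.ofReal (Real.exp (-(a / 2) * nsq (z - w)))) ^ p := by
        refine lintegral_mono fun z => ?_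
        rw [← ENNReal.mul_rpow_of_nonneg _ _ hp0.le]
        exact ENNReal.rpow_le_rpow (wt_fockT_le a f z) hp0.le
    _ = ‖((∫ u : Fin n → ℂ, Real.exp (-a * nsq u) : ℝ) : ℂ)⁻¹‖ₑ ^ p * ∫⁻ z,
        (∫⁻ w, wt a f w * ENNReal.ofReal (Real.exp (-(a / 2) * nsq (z - w)))) ^ p :=
        lintegral_const_mul' _ _ (ENNReal.rpow_ne_top_of_nonneg hp0.le enorm_ne_top)
    _ ≤ _ := by
        rw [fockC, ENNReal.mul_rpow_of_nonneg _ _ hp0.le, mul_assoc]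
        gcongr
        exact young_pow hp hwm
          (k := fun u => ENNReal.ofReal (Real.exp (-(a / 2) * nsq u))) (by fun_prop)

lemma fockT_congr {n : ℕ} {a : ℝ} {f g : (Fin n → ℂ) → ℂ} (h : f =ᵐ[volume] g) :
    fockT a f = fockT a g := by
  funext z
  unfold fockT
  congr 1
  refine integral_congr_ae ?_
  filter_upwards [h] with w hw
  rw [hw]

lemma memLp_fockT {n : ℕ} {s p a : ℝ} (hp : 1 ≤ p) (hs : 0 < s) (ha : 0 < a)
    (hap : a * p = 2 * s) {f : (Fin n → ℂ) → ℂ}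
    (hf : MemLp f (ENNReal.ofReal p) (gaussMeasure n s)) :
    MemLp (fockT a f) (ENNReal.ofReal p) (gaussMeasure n s) :=
  ⟨((FI_of_memLp hp hs ha hap hf).differentiable ha).continuous.aestronglyMeasurable,
    (eLpNorm_fockT_le hp hs hap hf.1).trans_lt (ENNReal.mul_lt_top (fockC_lt_top ha) hf.2)⟩

theorem stmt15 (n : ℕ) (s p : ℝ) (hs : 0 < s) (hp : 1 ≤ p) :
    letI : Fact (1 ≤ ENNReal.ofReal p) := ⟨ENNReal.one_le_ofReal.mpr hp⟩
    ∃ F : Submodule ℂ (Lp ℂ (ENNReal.ofReal p) (gaussMeasure n s)),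
      (F : Set (Lp ℂ (ENNReal.ofReal p) (gaussMeasure n s))) =
        {f : Lp ℂ (ENNReal.ofReal p) (gaussMeasure n s) |
          ∃ g : (Fin n → ℂ) → ℂ, Differentiable ℂ g ∧ ⇑f =ᵐ[gaussMeasure n s] g} ∧
      IsClosed (F : Set (Lp ℂ (ENNReal.ofReal p) (gaussMeasure n s))) ∧
      ∃ P : Lp ℂ (ENNReal.ofReal p) (gaussMeasure n s) →L[ℂ]
          Lp ℂ (ENNReal.ofReal p) (gaussMeasure n s),
        P.comp P = P ∧ LinearMap.range (P : Lp ℂ (ENNReal.ofReal p) (gaussMeasure n s) →ₗ[ℂ]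
          Lp ℂ (ENNReal.ofReal p) (gaussMeasure n s)) = F := by
  have : Fact (1 ≤ ENNReal.ofReal p) := ⟨ENNReal.one_le_ofReal.mpr hp⟩
  have hp0 : 0 < p := by linarith
  obtain ⟨a, ha, hap⟩ : ∃ a : ℝ, 0 < a ∧ a * p = 2 * s :=
    ⟨2 * s / p, by positivity, by field_simp⟩
  have hFI : ∀ f : Lp ℂ (ENNReal.ofReal p) (gaussMeasure n s), FI a f := fun f =>
    FI_of_memLp hp hs ha hap (Lp.memLp f)
  let P₀ : Lp ℂ (ENNReal.ofReal p) (gaussMeasure n s) →ₗ[ℂ]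
      Lp ℂ (ENNReal.ofReal p) (gaussMeasure n s) :=
    { toFun := fun f => (memLp_fockT hp hs ha hap (Lp.memLp f)).toLp (fockT a f)
      map_add' := by
        intro f g
        rw [← MemLp.toLp_add]
        refine MemLp.toLp_congr _ _ (Filter.Eventually.of_forall fun z => ?_)
        rw [fockT_congr ((ac_gauss hs).ae_le (Lp.coeFn_add f g))]
        simp only [fockT, Pi.add_apply, add_mul]
        rw [integral_add ((hFI f).integrable ha z) ((hFI g).integrable ha z), mul_add]
      map_smul' := by
        intro c f
        rw [RingHom.id_apply, ← MemLp.toLp_const_smul]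
        refine MemLp.toLp_congr _ _ (Filter.Eventually.of_forall fun z => ?_)
        rw [fockT_congr ((ac_gauss hs).ae_le (Lp.coeFn_smul c f))]
        simp only [fockT, Pi.smul_apply, smul_eq_mul, mul_assoc]
        rw [integral_const_mul]
        ring }
  let P : Lp ℂ (ENNReal.ofReal p) (gaussMeasure n s) →L[ℂ]
      Lp ℂ (ENNReal.ofReal p) (gaussMeasure n s) :=
    P₀.mkContinuous (fockC n a).toReal (by
      intro f
      change ‖(memLp_fockT hp hs ha hap (Lp.memLp f)).toLp (fockT a f)‖ ≤ _
      rw [Lp.norm_toLp, Lp.norm_def, ← ENNReal.toReal_mul]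
      exact ENNReal.toReal_mono (ENNReal.mul_ne_top (fockC_lt_top ha).ne (Lp.eLpNorm_ne_top f))
        (eLpNorm_fockT_le hp hs hap (Lp.memLp f).1))
  have hPae : ∀ f, ⇑(P f) =ᵐ[gaussMeasure n s] fockT a f := fun f =>
    (memLp_fockT hp hs ha hap (Lp.memLp f)).coeFn_toLp
  have hfix : ∀ f : Lp ℂ (ENNReal.ofReal p) (gaussMeasure n s),
      (∃ g : (Fin n → ℂ) → ℂ, Differentiable ℂ g ∧ ⇑f =ᵐ[gaussMeasure n s] g) → P f = f := by
    rintro f ⟨g, hg, hfg⟩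
    have hgI : FI a g := FI_of_memLp hp hs ha hap ((memLp_congr_ae hfg).1 (Lp.memLp f))
    refine Lp.ext ?_
    have h1 := hPae f
    rw [fockT_congr ((ac_gauss hs).ae_le hfg),
      show fockT a g = g from funext fun z => hgI.reproduce ha hg z] at h1
    exact h1.trans hfg.symm
  have hent : ∀ f : Lp ℂ (ENNReal.ofReal p) (gaussMeasure n s),
      ∃ g : (Fin n → ℂ) → ℂ, Differentiable ℂ g ∧ ⇑(P f) =ᵐ[gaussMeasure n s] g := fun f =>
    ⟨fockT a f, (hFI f).differentiable ha, hPae f⟩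
  have hset : ((LinearMap.range (P : Lp ℂ (ENNReal.ofReal p) (gaussMeasure n s) →ₗ[ℂ]
          Lp ℂ (ENNReal.ofReal p) (gaussMeasure n s)) : Submodule ℂ _) : Set _) =
      {f : Lp ℂ (ENNReal.ofReal p) (gaussMeasure n s) |
          ∃ g : (Fin n → ℂ) → ℂ, Differentiable ℂ g ∧ ⇑f =ᵐ[gaussMeasure n s] g} := by
    ext f
    constructor
    · rintro ⟨h, rfl⟩
      exact hent h
    · intro hf
      exact ⟨f, hfix f hf⟩
  refine ⟨_, hset, ?_, P, ?_, rfl⟩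
  · have : {f : Lp ℂ (ENNReal.ofReal p) (gaussMeasure n s) |
          ∃ g : (Fin n → ℂ) → ℂ, Differentiable ℂ g ∧ ⇑f =ᵐ[gaussMeasure n s] g} =
        {f | P f = f} := by
      ext f
      refine ⟨hfix f, fun h => ?_⟩
      have h2 := hent f
      rwa [show P f = f from h] at h2
    rw [hset, this]
    exact isClosed_eq P.continuous continuous_id
  · ext1 f
    exact hfix _ (hent f)
end
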